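/- Let (W, S) be a Coxeter system and define, for s ∈ S and b ∈ {0,1}, m(s, b) := s if b = 1 and the identity if b = 0; for sequences 𝐬 = (s₁,…,s_n) ∈ Sⁿ and 𝐛 ∈ {0,1}ⁿ let m(𝐬, 𝐛) := m(s₁,b₁)⋯m(s_n,b_n). Fix 𝐬 ∈ Sⁿ and let ε = (ε₁,…,ε_n) be i.i.d. uniform on {0,1}. If w and w' = wa (a ∈ S) are adjacent vertices with ℓ(w) < ℓ(w'), then ℙ[m(𝐬, ε) = w] ≥ ℙ[m(𝐬, ε) = w']. -/

import Mathlib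

namespace CoxeterSystem

theorem end_mul_apply {α : Type*} (f g : Function.End α) (x : α) : (f * g) x = f (g x) := rfl

variable {B W : Type*} [Group W] {M : CoxeterMatrix B} (cs : CoxeterSystem M W)

open scoped Classical in
/-- The signed conjugation by the simple reflection `s i` on `W × ZMod 2`: it conjugates the first
coordinate and changes the sign exactly at `s i`. -/
noncomputable def signedConj (i : B) : Function.End (W × ZMod 2) :=
  fun p => (cs.simple i * p.1 * cs.simple i, p.2 + if p.1 = cs.simple i then 1 else 0)

open scoped Classical in
theorem signedConj_mul_pow_apply (i j : B) (n : ℕ) (p : W × ZMod 2) :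
    ((cs.signedConj i * cs.signedConj j) ^ n) p =
      ((cs.simple i * cs.simple j) ^ n * p.1 * ((cs.simple i * cs.simple j) ^ n)⁻¹,
        p.2 + ∑ r ∈ Finset.range (2 * n),
          if p.1 = cs.simple j * (cs.simple i * cs.simple j) ^ r then 1 else 0) := by
  induction n with
  | zero => simp [Function.End.one_def]
  | succ n ih =>
    rw [pow_succ' (cs.signedConj i * cs.signedConj j), end_mul_apply,
      ih, end_mul_apply]
    set c := cs.simple i * cs.simple j with hc
    have hinv : c⁻¹ = cs.simple j * cs.simple i := by simp [hc]
    have hconj (k : ℕ) : (c ^ k)⁻¹ * cs.simple j = cs.simple j * c ^ k := by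
      induction k with
      | zero => simp
      | succ k ihk =>
        rw [pow_succ, mul_inv_rev, mul_assoc, ihk, hinv, ← pow_succ, pow_succ']
        simp [hc, mul_assoc]
    have h₁ : c ^ n * p.1 * (c ^ n)⁻¹ = cs.simple j ↔ p.1 = cs.simple j * c ^ (2 * n) := by
      rw [mul_inv_eq_iff_eq_mul, ← eq_inv_mul_iff_mul_eq, ← mul_assoc, hconj, mul_assoc,
        ← pow_add, two_mul]
    have h₂ : cs.simple j * (c ^ n * p.1 * (c ^ n)⁻¹) * cs.simple j = cs.simple i ↔
        p.1 = cs.simple j * c ^ (2 * n + 1) := by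
      have : cs.simple j * (c ^ n * p.1 * (c ^ n)⁻¹) * cs.simple j = cs.simple i ↔
          c ^ n * p.1 * (c ^ n)⁻¹ = cs.simple j * c := by
        rw [← eq_mul_inv_iff_mul_eq, ← eq_inv_mul_iff_mul_eq, cs.inv_simple]
      rw [this, mul_inv_eq_iff_eq_mul, ← eq_inv_mul_iff_mul_eq, ← mul_assoc, ← mul_assoc, hconj,
        mul_assoc, mul_assoc, ← pow_succ', ← pow_add]
      ring_nf
    refine Prod.ext ?_ ?_
    · simp [signedConj, pow_succ', hc, mul_assoc]
    · simp only [signedConj, h₁, h₂, Nat.mul_succ, Finset.sum_range_succ, add_assoc]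

theorem isLiftable_signedConj : M.IsLiftable cs.signedConj := by
  classical
  intro i j
  funext p
  rw [signedConj_mul_pow_apply, two_mul, Finset.sum_range_add]
  simp [pow_add, Function.End.one_def, CharTwo.add_self_eq_zero]

/-- The action of `W` on `W × ZMod 2` by signed conjugations. -/
noncomputable def signedConjHom : W →* Function.End (W × ZMod 2) :=
  cs.lift ⟨cs.signedConj, cs.isLiftable_signedConj⟩

@[simp] theorem signedConjHom_simple (i : B) :
    cs.signedConjHom (cs.simple i) = cs.signedConj i :=
  cs.lift_apply_simple cs.isLiftable_signedConj i

open scoped Classical in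
theorem signedConjHom_wordProd (ω : List B) (p : W × ZMod 2) :
    cs.signedConjHom (cs.wordProd ω) p =
      (cs.wordProd ω * p.1 * (cs.wordProd ω)⁻¹, p.2 + (cs.rightInvSeq ω).count p.1) := by
  induction ω with
  | nil => simp [Function.End.one_def]
  | cons i ω ih =>
    rw [wordProd_cons, map_mul, end_mul_apply, ih,
      signedConjHom_simple]
    have : cs.wordProd ω * p.1 * (cs.wordProd ω)⁻¹ = cs.simple i ↔
        (cs.wordProd ω)⁻¹ * cs.simple i * cs.wordProd ω = p.1 := by
      rw [mul_inv_eq_iff_eq_mul, ← eq_inv_mul_iff_mul_eq, eq_comm, mul_assoc]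
    refine Prod.ext ?_ ?_
    · simp [signedConj, mul_assoc]
    · simp [signedConj, rightInvSeq, List.count_cons, this, add_assoc]

theorem signedConjHom_apply_fst (w : W) (p : W × ZMod 2) :
    (cs.signedConjHom w p).1 = w * p.1 * w⁻¹ := by
  classical
  obtain ⟨ω, rfl⟩ := cs.wordProd_surjective w
  rw [signedConjHom_wordProd]

theorem signedConjHom_apply_snd (w : W) (p : W × ZMod 2) :
    (cs.signedConjHom w p).2 = p.2 + (cs.signedConjHom w (p.1, 0)).2 := by
  classical
  obtain ⟨ω, rfl⟩ := cs.wordProd_surjective w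
  simp [signedConjHom_wordProd]

theorem isRightDescent_of_signedConjHom_ne_zero {w : W} {a : B}
    (h : (cs.signedConjHom w (cs.simple a, 0)).2 ≠ 0) : cs.IsRightDescent w a := by
  classical
  obtain ⟨ω, hω, rfl⟩ := cs.exists_isReduced w
  rw [← isRightInversion_simple_iff_isRightDescent]
  refine cs.isRightInversion_of_mem_rightInvSeq hω ?_
  by_contra hmem
  simp [signedConjHom_wordProd, List.count_eq_zero_of_not_mem hmem] at h

theorem isRightDescent_iff_signedConjHom_ne_zero {w : W} {a : B} :
    cs.IsRightDescent w a ↔ (cs.signedConjHom w (cs.simple a, 0)).2 ≠ 0 := by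
  refine ⟨fun h h₀ => ?_, cs.isRightDescent_of_signedConjHom_ne_zero⟩
  have h₁ : cs.IsRightDescent (w * cs.simple a) a := by
    apply cs.isRightDescent_of_signedConjHom_ne_zero
    rw [map_mul, end_mul_apply, signedConjHom_apply_snd,
      signedConjHom_simple]
    simp [signedConj, h₀]
  rw [IsRightDescent, simple_mul_simple_cancel_right] at h₁
  exact lt_asymm h h₁

/-- The folding condition: if `a` is a right descent of `s i * w` but not of `w`, then
`s i * w = w * s a`. -/
theorem simple_mul_eq_mul_simple {w : W} {i a : B} (h : ¬cs.IsRightDescent w a)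
    (h' : cs.IsRightDescent (cs.simple i * w) a) : cs.simple i * w = w * cs.simple a := by
  rw [isRightDescent_iff_signedConjHom_ne_zero, not_not] at h
  rw [isRightDescent_iff_signedConjHom_ne_zero, map_mul, end_mul_apply, signedConjHom_simple] at h'
  by_contra hne
  refine h' ?_
  simp only [signedConj, h, zero_add]
  refine if_neg fun e => hne ?_
  rw [signedConjHom_apply_fst, mul_inv_eq_iff_eq_mul] at e
  exact e.symm

/-- The number of ways to write `w` as the product of a subword of `ω`. -/
noncomputable def subwordCount (ω : List B) (w : W) : ℕ :=
  Nat.card {b : Fin ω.length → Bool |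
    ((List.finRange ω.length).map (fun k => if b k then cs.simple (ω.get k) else 1)).prod = w}

theorem subwordCount_nil_of_ne_one {w : W} (hw : w ≠ 1) : cs.subwordCount [] w = 0 := by
  simp [subwordCount, hw.symm]

theorem subwordCount_cons (i : B) (ω : List B) (w : W) :
    cs.subwordCount (i :: ω) w = cs.subwordCount ω (cs.simple i * w) + cs.subwordCount ω w := by
  classical
  have h (x : W) : cs.simple i * x = w ↔ x = cs.simple i * w := by
    rw [← eq_inv_mul_iff_mul_eq, inv_simple]
  simp only [subwordCount, Set.coe_ofPred, Nat.card_eq_fintype_card, Fintype.card_subtype,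
    Finset.card_filter]
  refine ((Fin.consEquiv fun _ : Fin (ω.length + 1) => Bool).sum_comp _).symm.trans ?_
  rw [Fintype.sum_prod_type, Fintype.sum_bool]
  simp [Fin.consEquiv, List.finRange_succ, Function.comp_def, h]

/-- Multiplying by a generator that increases the length does not increase the number of
representations as the product of a subword. -/
theorem subwordCount_mul_simple_le (ω : List B) {w : W} {a : B} (h : ¬cs.IsRightDescent w a) :
    cs.subwordCount ω (w * cs.simple a) ≤ cs.subwordCount ω w := by
  induction ω generalizing w with
  | nil =>
    rw [subwordCount_nil_of_ne_one]
    · exact Nat.zero_le _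
    · intro h₁
      have := cs.length_mul_simple_ne w a
      rw [IsRightDescent] at h
      rw [h₁, length_one] at h this
      omega
  | cons i ω ih =>
    rw [subwordCount_cons, subwordCount_cons]
    by_cases h' : cs.IsRightDescent (cs.simple i * w) a
    · rw [← cs.simple_mul_eq_mul_simple h h', simple_mul_simple_cancel_left, add_comm]
    · rw [← mul_assoc]
      exact add_le_add (ih h') (ih h)

end CoxeterSystem


/-- Let `(W, S)` be a Coxeter system and fix a word `ω` over the generators.
For coin flips `b : Fin |ω| → Bool` define `m(ω, b)` as the ordered product of `s(ωₖ)` over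
the indices `k` with `b k = true` (and `1` otherwise).  If `w, w' = w·a` are adjacent with
`ℓ(w) < ℓ(w')`, then the number of coin-flip sequences with `m(ω, b) = w'` is at most the
number with `m(ω, b) = w`; i.e. `ℙ[m(ω, ε) = w] ≥ ℙ[m(ω, ε) = w']` for uniform `ε`. -/
theorem stmt_13 {B W : Type*} [Group W] {M : CoxeterMatrix B} (cs : CoxeterSystem M W)
    (ω : List B) (w : W) (a : B)
    (h : cs.length w < cs.length (w * cs.simple a)) :
    Nat.card {b : Fin ω.length → Bool |
        ((List.finRange ω.length).map
          (fun k => if b k then cs.simple (ω.get k) else 1)).prod = w * cs.simple a} ≤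
    Nat.card {b : Fin ω.length → Bool |
        ((List.finRange ω.length).map
          (fun k => if b k then cs.simple (ω.get k) else 1)).prod = w} := by
  exact cs.subwordCount_mul_simple_le ω h.not_gt
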